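/- (Theorem 1.1, integral-equation form.) Let a > 0, let q : ℝ³ → ℝ be continuous with q(x) ≥ a² for all x, put p = q − a², and assume p is bounded. Let f : ℝ → ℝ be continuously differentiable. Fix R > 0, set M(R) = sup_{|t|≤R} |f(t)| and M₁(R) = sup_{|t|≤2R} |f'(t)|, and assume (‖p‖∞ · R + M(R))/a² ≤ R and (‖p‖∞ + M₁(R))/a² ≤ γ for some γ with 0 < γ < 1. Then for every ε > 0 there exists a unique bounded continuous function u_ε : ℝ³ → ℝ with ‖u_ε‖∞ ≤ R satisfying u_ε(x) = ∫_{ℝ³} g_{a,ε}(x,y)(−p(y) u_ε(y) + f(u_ε(y))) dy for all x ∈ ℝ³. Moreover, if f(0) ≠ 0 then u_ε is not identically zero. -/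

import Mathlib

open MeasureTheory Set BoundedContinuousFunction

/-- The screened Poisson (Yukawa) kernel is integrable on `ℝ³` with total mass `1 / a²`. -/
theorem integral_yukawa_kernel {a ε : ℝ} (ha : 0 < a) (hε : 0 < ε) :
    ∫ z : EuclideanSpace ℝ (Fin 3),
      Real.exp (-(a / ε) * ‖z‖) / (4 * Real.pi * ε ^ 2 * ‖z‖) = 1 / a ^ 2 := by
  have hb : 0 < a / ε := div_pos ha hε
  have hgamma : ∫ r in Ioi (0 : ℝ), r ^ (3 - 1) *
      (Real.exp (-(a / ε) * r) / (4 * Real.pi * ε ^ 2 * r)) = 1 / (4 * Real.pi * a ^ 2) := by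
    have h := Real.integral_rpow_mul_exp_neg_mul_Ioi (a := 2) (r := a / ε) (by norm_num) hb
    have hcongr : ∫ r in Ioi (0 : ℝ), r ^ (3 - 1) *
        (Real.exp (-(a / ε) * r) / (4 * Real.pi * ε ^ 2 * r)) =
        ∫ r in Ioi (0 : ℝ), (1 / (4 * Real.pi * ε ^ 2)) *
          (r ^ ((2 : ℝ) - 1) * Real.exp (-(a / ε * r))) := by
      refine setIntegral_congr_fun measurableSet_Ioi fun r hr => ?_
      have hr : r ≠ 0 := (mem_Ioi.1 hr).ne'
      have h1 : r ^ ((2 : ℝ) - 1) = r := by norm_num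
      simp only [h1, neg_mul]
      field_simp
    rw [hcongr, integral_const_mul, h, Real.Gamma_two, Real.rpow_two]
    field_simp
  rw [integral_fun_norm_addHaar volume
    (fun r => Real.exp (-(a / ε) * r) / (4 * Real.pi * ε ^ 2 * r))]
  simp only [finrank_euclideanSpace, Fintype.card_fin, smul_eq_mul, hgamma, measureReal_def,
    EuclideanSpace.volume_ball_fin_three]
  have hball : (0 : ℝ) ≤ Real.pi * 4 / 3 := by positivity
  simp only [ENNReal.ofReal_one, one_pow, one_mul, ENNReal.toReal_ofReal hball, nsmul_eq_mul]
  push_cast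
  field_simp

theorem integrable_yukawa_kernel {a ε : ℝ} (ha : 0 < a) (hε : 0 < ε) :
    Integrable (fun z : EuclideanSpace ℝ (Fin 3) =>
      Real.exp (-(a / ε) * ‖z‖) / (4 * Real.pi * ε ^ 2 * ‖z‖)) := by
  by_contra h
  have h1 := integral_yukawa_kernel ha hε
  rw [integral_undef h] at h1
  have : 0 < 1 / a ^ 2 := by positivity
  linarith

section Convolution

variable {E : Type*} [NormedAddCommGroup E] [MeasurableSpace E] [BorelSpace E]
  {μ : Measure E} [μ.IsAddLeftInvariant] [μ.IsNegInvariant]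

/-- Convolution of an integrable kernel with a bounded continuous function. -/
theorem exists_boundedContinuous_convolution {k : E → ℝ} (hk : Integrable k μ) (h : E →ᵇ ℝ) :
    ∃ w : E →ᵇ ℝ, ∀ x, w x = ∫ y, k (x - y) * h y ∂μ := by
  have heq : ∀ x, ∫ y, k (x - y) * h y ∂μ = ∫ y, k y * h (x - y) ∂μ := fun x => by
    rw [← integral_sub_left_eq_self (fun y => k y * h (x - y)) μ x]
    simp
  have hcont : Continuous fun x => ∫ y, k y * h (x - y) ∂μ := by
    refine continuous_of_dominated (bound := fun y => ‖k y‖ * ‖h‖) (fun x => ?_)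
      (fun x => ?_) (hk.norm.mul_const _) ?_
    · exact hk.aestronglyMeasurable.mul
        (h.continuous.comp (continuous_const.sub continuous_id)).aestronglyMeasurable
    · refine Filter.Eventually.of_forall fun y => ?_
      rw [norm_mul]
      gcongr
      exact h.norm_coe_le_norm _
    · exact Filter.Eventually.of_forall fun y => by fun_prop
  refine ⟨BoundedContinuousFunction.ofNormedAddCommGroup _ hcont ((∫ y, ‖k y‖ ∂μ) * ‖h‖)
    fun x => ?_, fun x => (heq x).symm⟩
  rw [← integral_mul_const]
  refine norm_integral_le_of_norm_le (hk.norm.mul_const _)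
    (Filter.Eventually.of_forall fun y => ?_)
  rw [norm_mul]
  gcongr
  exact h.norm_coe_le_norm _

theorem abs_integral_kernel_mul_le {k : E → ℝ} (hk : Integrable k μ) (hk0 : ∀ z, 0 ≤ k z)
    {h : E → ℝ} {C : ℝ} (hC : ∀ y, |h y| ≤ C) (x : E) :
    |∫ y, k (x - y) * h y ∂μ| ≤ (∫ z, k z ∂μ) * C := by
  rw [← integral_sub_left_eq_self k μ x, ← integral_mul_const, ← Real.norm_eq_abs]
  refine norm_integral_le_of_norm_le ((hk.comp_sub_left x).mul_const _)
    (Filter.Eventually.of_forall fun y => ?_)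
  rw [Real.norm_eq_abs, abs_mul, abs_of_nonneg (hk0 _)]
  exact mul_le_mul_of_nonneg_left (hC y) (hk0 _)

theorem integrable_kernel_mul {k : E → ℝ} (hk : Integrable k μ) (h : E →ᵇ ℝ) (x : E) :
    Integrable (fun y => k (x - y) * h y) μ :=
  (hk.comp_sub_left x).mul_bdd h.continuous.aestronglyMeasurable
    (Filter.Eventually.of_forall h.norm_coe_le_norm)

/-- Banach fixed point theorem for a Hammerstein equation `u = k ⋆ N u` on a ball. -/
theorem existsUnique_hammerstein {k : E → ℝ} (hk : Integrable k μ) (hk0 : ∀ z, 0 ≤ k z)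
    {R C L : ℝ} (hR : 0 ≤ R) (N : E → ℝ → ℝ) (hN : Continuous fun z : E × ℝ => N z.1 z.2)
    (hC : ∀ y t, |t| ≤ R → |N y t| ≤ C)
    (hL : ∀ y s t, |s| ≤ R → |t| ≤ R → |N y s - N y t| ≤ L * |s - t|)
    (hL0 : 0 ≤ L) (hCR : (∫ z, k z ∂μ) * C ≤ R) (hL1 : (∫ z, k z ∂μ) * L < 1) :
    ∃! u : E →ᵇ ℝ, ‖u‖ ≤ R ∧ ∀ x, u x = ∫ y, k (x - y) * N y (u y) ∂μ := by
  have habs : ∀ u : E →ᵇ ℝ, ‖u‖ ≤ R → ∀ y, |u y| ≤ R :=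
    fun u hu y => (u.norm_coe_le_norm y).trans hu
  have hNu : ∀ u : E →ᵇ ℝ, ‖u‖ ≤ R → ∃ h : E →ᵇ ℝ, ∀ y, h y = N y (u y) := fun u hu =>
    ⟨BoundedContinuousFunction.ofNormedAddCommGroup (fun y => N y (u y))
      (hN.comp (continuous_id.prodMk u.continuous)) C fun y => hC _ _ (habs u hu y),
      fun _ => rfl⟩
  have hT : ∀ u : Metric.closedBall (0 : E →ᵇ ℝ) R, ∃ w : Metric.closedBall (0 : E →ᵇ ℝ) R,
      ∀ x, w.1 x = ∫ y, k (x - y) * N y (u.1 y) ∂μ := by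
    rintro ⟨u, hu⟩
    rw [mem_closedBall_zero_iff] at hu
    obtain ⟨h, hh⟩ := hNu u hu
    obtain ⟨w, hw⟩ := exists_boundedContinuous_convolution hk h
    simp only [hh] at hw
    refine ⟨⟨w, ?_⟩, hw⟩
    rw [mem_closedBall_zero_iff, BoundedContinuousFunction.norm_le hR]
    intro x
    rw [hw x]
    exact (abs_integral_kernel_mul_le hk hk0 (fun y => hC _ _ (habs u hu y)) x).trans hCR
  choose T hT using hT
  have hK0 : 0 ≤ (∫ z, k z ∂μ) * L := mul_nonneg (integral_nonneg hk0) hL0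
  have hcontr : ContractingWith ⟨(∫ z, k z ∂μ) * L, hK0⟩ T := by
    refine ⟨by exact_mod_cast hL1, LipschitzWith.of_dist_le_mul fun u v => ?_⟩
    have hu := mem_closedBall_zero_iff.1 u.2
    have hv := mem_closedBall_zero_iff.1 v.2
    obtain ⟨hu', hhu⟩ := hNu u hu
    obtain ⟨hv', hhv⟩ := hNu v hv
    refine (BoundedContinuousFunction.dist_le (mul_nonneg hK0 dist_nonneg)).2 fun x => ?_
    have iu := integrable_kernel_mul hk hu' x
    have iv := integrable_kernel_mul hk hv' x
    simp only [hhu] at iu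
    simp only [hhv] at iv
    rw [hT, hT, Real.dist_eq, ← integral_sub iu iv]
    simp only [← mul_sub]
    refine (abs_integral_kernel_mul_le hk hk0 (C := L * dist u v) (fun y => ?_) x).trans
      (mul_assoc _ _ _).ge
    refine (hL _ _ _ (habs u hu y) (habs v hv y)).trans (mul_le_mul_of_nonneg_left ?_ hL0)
    exact BoundedContinuousFunction.dist_coe_le_dist (f := u.1) (g := v.1) y
  have : CompleteSpace (Metric.closedBall (0 : E →ᵇ ℝ) R) :=
    Metric.isClosed_closedBall.completeSpace_coe
  have : Nonempty (Metric.closedBall (0 : E →ᵇ ℝ) R) := ⟨⟨0, Metric.mem_closedBall_self hR⟩⟩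
  refine ⟨(hcontr.fixedPoint T).1, ⟨mem_closedBall_zero_iff.1 (hcontr.fixedPoint T).2,
    fun x => ?_⟩, ?_⟩
  · rw [← hT, hcontr.fixedPoint_isFixedPt]
  · rintro v ⟨hv, hvT⟩
    refine congrArg Subtype.val (hcontr.fixedPoint_unique
      (x := ⟨v, mem_closedBall_zero_iff.2 hv⟩) (Subtype.ext ?_))
    ext x
    rw [hT, hvT x]

end Convolution

theorem abs_le_sSup_image_abs {g : ℝ → ℝ} (hg : Continuous g) {c d t : ℝ} (ht : t ∈ Icc c d) :
    |g t| ≤ sSup ((fun t => |g t|) '' Icc c d) :=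
  le_csSup (isCompact_Icc.image hg.abs).bddAbove (mem_image_of_mem _ ht)


/-- Theorem 1.1 (integral-equation form). Here the potential is `q = p + a²` with
`p` bounded, continuous and nonnegative (equivalently, `q` is continuous with
`q ≥ a²` and `p = q - a²` bounded). Under the smallness conditions
`(‖p‖∞ R + M(R))/a² ≤ R` and `(‖p‖∞ + M₁(R))/a² ≤ γ < 1`, for every `ε > 0`
there is a unique bounded continuous `u_ε` with `‖u_ε‖∞ ≤ R` solving
`u_ε(x) = ∫ g_{a,ε}(x,y)(-p(y)u_ε(y) + f(u_ε(y))) dy`; moreover if `f(0) ≠ 0`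
then `u_ε ≠ 0`. -/
theorem existence_uniqueness_integral_equation (a R γ : ℝ) (ha : 0 < a) (hR : 0 < R)
    (hγ0 : 0 < γ) (hγ1 : γ < 1)
    (p : BoundedContinuousFunction (EuclideanSpace ℝ (Fin 3)) ℝ) (hp : ∀ x, 0 ≤ p x)
    (q : EuclideanSpace ℝ (Fin 3) → ℝ) (hq : ∀ x, q x = p x + a ^ 2)
    (f : ℝ → ℝ) (hf : ContDiff ℝ 1 f)
    (M : ℝ) (hM : M = sSup ((fun t => |f t|) '' Set.Icc (-R) R))
    (M₁ : ℝ) (hM₁ : M₁ = sSup ((fun t => |deriv f t|) '' Set.Icc (-(2 * R)) (2 * R)))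
    (hcond1 : (‖p‖ * R + M) / a ^ 2 ≤ R)
    (hcond2 : (‖p‖ + M₁) / a ^ 2 ≤ γ) :
    (∀ ε : ℝ, 0 < ε →
      ∃! u : BoundedContinuousFunction (EuclideanSpace ℝ (Fin 3)) ℝ,
        ‖u‖ ≤ R ∧
        ∀ x : EuclideanSpace ℝ (Fin 3),
          u x = ∫ y : EuclideanSpace ℝ (Fin 3),
            Real.exp (-(a / ε) * ‖x - y‖) / (4 * Real.pi * ε ^ 2 * ‖x - y‖) *
              (-(p y) * u y + f (u y))) ∧
    (f 0 ≠ 0 → ∀ ε : ℝ, 0 < ε →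
      ∀ u : BoundedContinuousFunction (EuclideanSpace ℝ (Fin 3)) ℝ,
        (‖u‖ ≤ R ∧
          ∀ x : EuclideanSpace ℝ (Fin 3),
            u x = ∫ y : EuclideanSpace ℝ (Fin 3),
              Real.exp (-(a / ε) * ‖x - y‖) / (4 * Real.pi * ε ^ 2 * ‖x - y‖) *
                (-(p y) * u y + f (u y))) → u ≠ 0) := by
  have hk := fun {ε : ℝ} (hε : 0 < ε) => integrable_yukawa_kernel ha hε
  have hkint := fun {ε : ℝ} (hε : 0 < ε) => integral_yukawa_kernel ha hε
  have ha2 : 0 < a ^ 2 := by positivity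
  have hM_le : ∀ t, |t| ≤ R → |f t| ≤ M := fun t ht =>
    hM ▸ abs_le_sSup_image_abs hf.continuous (abs_le.1 ht)
  have hderiv_le : ∀ t ∈ Icc (-R) R, ‖deriv f t‖ ≤ M₁ := fun t ht =>
    hM₁ ▸ abs_le_sSup_image_abs (hf.continuous_deriv le_rfl)
      ⟨by linarith [ht.1], by linarith [ht.2]⟩
  have hM₁0 : 0 ≤ M₁ := (norm_nonneg _).trans (hderiv_le 0 ⟨by linarith, hR.le⟩)
  have hf_lip : ∀ s t, |s| ≤ R → |t| ≤ R → |f s - f t| ≤ M₁ * |s - t| := fun s t hs ht =>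
    (convex_Icc (-R) R).norm_image_sub_le_of_norm_deriv_le
      (fun x _ => (hf.differentiable one_ne_zero).differentiableAt) hderiv_le
      (abs_le.1 ht) (abs_le.1 hs)
  have hp_le : ∀ y, |p y| ≤ ‖p‖ := p.norm_coe_le_norm
  refine ⟨fun ε hε => ?_, ?_⟩
  · refine existsUnique_hammerstein (hk hε) (fun z => by positivity) hR.le
      (C := ‖p‖ * R + M) (L := ‖p‖ + M₁) (fun y t => -(p y) * t + f t) ?_ ?_ ?_
      (add_nonneg (norm_nonneg _) hM₁0) ?_ ?_
    · have := hf.continuous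
      fun_prop
    · intro y t ht
      refine (abs_add_le _ _).trans (add_le_add ?_ (hM_le t ht))
      rw [abs_mul, abs_neg]
      exact mul_le_mul (hp_le y) ht (abs_nonneg _) (norm_nonneg _)
    · intro y s t hs ht
      have heq : -(p y) * s + f s - (-(p y) * t + f t) = -(p y) * (s - t) + (f s - f t) := by
        ring
      rw [heq, add_mul]
      refine (abs_add_le _ _).trans (add_le_add ?_ (hf_lip s t hs ht))
      rw [abs_mul, abs_neg]
      exact mul_le_mul_of_nonneg_right (hp_le y) (abs_nonneg _)
    · rwa [hkint hε, one_div_mul_eq_div]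
    · rw [hkint hε, one_div_mul_eq_div]
      exact hcond2.trans_lt hγ1
  · rintro hf0 ε hε u ⟨-, hu⟩ rfl
    have h := hu 0
    simp only [BoundedContinuousFunction.coe_zero, Pi.zero_apply, mul_zero, zero_add, zero_sub,
      norm_neg, integral_mul_const, hkint hε] at h
    exact mul_ne_zero (by positivity) hf0 h.symm
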